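/- Let G = G1 ×_I G2 be a discrete cusp with I ⊆ V2 nonempty. Then the form domains satisfy D(Δ_{G,θ}^{1/2}) = D((m1^{-1}(·) ⊗ Δ_{G2,θ2})^{1/2}), and the magnetic Laplacian Δ_{G,θ} has compact resolvent if and only if Hol_{θ2} ≠ 0 (some cycle of G2 has nonzero holonomy). -/

import Mathlib

open scoped BigOperators ENNReal

noncomputable section

namespace MagneticCusp

attribute [local instance] Classical.propDecidable

variable {V V1 V2 : Type*}

/-- The axioms of a weighted graph `(E, V, m)`: `E` is symmetric, non-negative,
with no loops, `m` is a positive weight, and the graph is locally finite. -/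
def GraphAxioms (E : V → V → ℝ) (m : V → ℝ) : Prop :=
  (∀ x y, E x y = E y x) ∧ (∀ x y, 0 ≤ E x y) ∧ (∀ x, E x x = 0) ∧ (∀ x, 0 < m x) ∧
    ∀ x, {y | 0 < E x y}.Finite

/-- Connectedness of the graph with edge weight `E`. -/
def Conn (E : V → V → ℝ) : Prop :=
  ∀ x y, Relation.ReflTransGen (fun a b => 0 < E a b) x y

/-- A (real representative of a) magnetic potential: antisymmetric, vanishing off edges. -/
def MagneticPotential (E θ : V → V → ℝ) : Prop :=
  (∀ x y, θ y x = -θ x y) ∧ ∀ x y, E x y = 0 → θ x y = 0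

/-- `γ` is a cycle of length `N` in the graph with edge weight `E`. -/
def IsCycle (E : V → V → ℝ) (γ : ℕ → V) (N : ℕ) : Prop :=
  γ N = γ 0 ∧ ∀ i < N, 0 < E (γ i) (γ (i + 1))

/-- The holonomy (flux) of the magnetic potential `θ` along `γ` (a real representative;
it is to be considered modulo `2π`). -/
def hol (θ : V → V → ℝ) (γ : ℕ → V) (N : ℕ) : ℝ :=
  ∑ i ∈ Finset.range N, θ (γ i) (γ (i + 1))

/-- `Hol_θ = 0`: every cycle has vanishing holonomy in `ℝ/2πℤ`. -/
def HolTrivial (E θ : V → V → ℝ) : Prop :=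
  ∀ (γ : ℕ → V) (N : ℕ), IsCycle E γ N → ∃ k : ℤ, hol θ γ N = 2 * Real.pi * k

/-- The magnetic Laplacian `Δ_{G,θ}` acting on functions. -/
def lap (E : V → V → ℝ) (m : V → ℝ) (θ : V → V → ℝ) (f : V → ℂ) (x : V) : ℂ :=
  ((m x : ℝ) : ℂ)⁻¹ *
    ∑' y, ((E x y : ℝ) : ℂ) * (f x - Complex.exp (((θ x y : ℝ) : ℂ) * Complex.I) * f y)

/-- The magnetic quadratic form `Q_{G,θ}`. -/
def quadForm (E θ : V → V → ℝ) (f : V → ℂ) : ℝ :=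
  (1 / 2) * ∑' x, ∑' y, E x y * ‖f x - Complex.exp (((θ x y : ℝ) : ℂ) * Complex.I) * f y‖ ^ 2

/-- The degree `deg_G(x) = m(x)⁻¹ Σ_y E(x,y)`. -/
def degree (E : V → V → ℝ) (m : V → ℝ) (x : V) : ℝ := (m x)⁻¹ * ∑' y, E x y

/-- The squared norm of `f` in `ℓ²(V,m)`. -/
def nrmSq (m : V → ℝ) (f : V → ℂ) : ℝ := ∑' x, m x * ‖f x‖ ^ 2

/-- Membership in `ℓ²(V,m)`. -/
def MemL2 (m : V → ℝ) (f : V → ℂ) : Prop := Summable fun x => m x * ‖f x‖ ^ 2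

/-- The quadratic form `⟨f, deg_G(·) f⟩` of the multiplication operator by the degree. -/
def degForm (E : V → V → ℝ) (m : V → ℝ) (f : V → ℂ) : ℝ :=
  ∑' x, m x * degree E m x * ‖f x‖ ^ 2

/-- Weight of the product of two weighted graphs. -/
def prodM (m1 : V1 → ℝ) (m2 : V2 → ℝ) : V1 × V2 → ℝ := fun p => m1 p.1 * m2 p.2

/-- Edge weight of the product of `G1` by `G2` through `I ⊆ V2`. -/
def prodE (E1 : V1 → V1 → ℝ) (E2 : V2 → V2 → ℝ) (I : Set V2) :
    V1 × V2 → V1 × V2 → ℝ := fun p q =>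
  (if p.2 = q.2 ∧ p.2 ∈ I then E1 p.1 q.1 else 0) + (if p.1 = q.1 then E2 p.2 q.2 else 0)

/-- Edge weight of the Cartesian product of `G1` by `G2`. -/
def cartE (E1 : V1 → V1 → ℝ) (m1 : V1 → ℝ) (E2 : V2 → V2 → ℝ) (m2 : V2 → ℝ) :
    V1 × V2 → V1 × V2 → ℝ := fun p q =>
  (if p.2 = q.2 then E1 p.1 q.1 * m2 p.2 else 0) + (if p.1 = q.1 then m1 p.1 * E2 p.2 q.2 else 0)

/-- Magnetic potential of the product of `G1` by `G2`. -/
def prodTheta (θ1 : V1 → V1 → ℝ) (θ2 : V2 → V2 → ℝ) : V1 × V2 → V1 × V2 → ℝ := fun p q =>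
  (if p.2 = q.2 then θ1 p.1 q.1 else 0) + (if p.1 = q.1 then θ2 p.2 q.2 else 0)

/-- Hypothesis (H1): `m1(x) → 0` as `x → ∞` (on an infinite vertex set). -/
def H1cond (m1 : V1 → ℝ) : Prop :=
  Infinite V1 ∧ ∀ ε : ℝ, 0 < ε → {x : V1 | ε ≤ m1 x}.Finite

/-- Hypothesis (H3): the degree of `G1` is bounded. -/
def H3cond (E1 : V1 → V1 → ℝ) (m1 : V1 → ℝ) : Prop :=
  ∃ d : ℝ, ∀ x, degree E1 m1 x ≤ d

/-- The quadratic form of the operator `m1⁻¹(·) ⊗ Δ_{G2,θ2}` on `ℓ²(V1 × V2, m1 ⊗ m2)`: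
`⟨f, (m1⁻¹(·) ⊗ Δ_{G2,θ2}) f⟩ = Σ_x Q_{G2,θ2}(f(x,·))`. -/
def fiberForm (E2 θ2 : V2 → V2 → ℝ) (f : V1 × V2 → ℂ) : ℝ :=
  ∑' x : V1, quadForm E2 θ2 fun y => f (x, y)

/-- A simple cycle: closed walk of length `≥ 3` with pairwise distinct vertices. -/
def IsSimpleCycle (E : V → V → ℝ) (γ : ℕ → V) (N : ℕ) : Prop :=
  3 ≤ N ∧ γ N = γ 0 ∧ (∀ i < N, 0 < E (γ i) (γ (i + 1))) ∧
    ∀ i < N, ∀ j < N, γ i = γ j → i = j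

/-- The weighted length of an edge, `L_G(x,y) = sqrt(min(m x, m y)/E x y)`. -/
def edgeLength (E : V → V → ℝ) (m : V → ℝ) (x y : V) : ℝ :=
  Real.sqrt (min (m x) (m y) / E x y)

/-- The weighted length of a cycle. -/
def cycleLength (E : V → V → ℝ) (m : V → ℝ) (γ : ℕ → V) (N : ℕ) : ℝ :=
  ∑ i ∈ Finset.range N, edgeLength E m (γ i) (γ (i + 1))

/-- The (weighted) girth: infimum of the weighted lengths of simple cycles (`∞` if none). -/
def girth (E : V → V → ℝ) (m : V → ℝ) : ℝ≥0∞ :=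
  ⨅ c : {c : (ℕ → V) × ℕ // IsSimpleCycle E c.1 c.2},
    ENNReal.ofReal (cycleLength E m c.1.1 c.1.2)

/-- The radius of injectivity: half the girth. -/
def injRad (E : V → V → ℝ) (m : V → ℝ) : ℝ≥0∞ := girth E m / 2

/-- Min-max encoding: there is an `n`-dimensional subspace of finitely supported
functions (the form core) on which `Q ≤ lam ‖·‖²_{ℓ²(V,m)}`.  For the self-adjoint
operator associated to the form `Q` with form core `C_c(V)` this says
`N_lam(H) = dim ran 1_{(-∞,lam]}(H) ≥ n`. -/
def DimGE (Q : (V → ℂ) → ℝ) (m : V → ℝ) (lam : ℝ) (n : ℕ) : Prop :=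
  ∃ g : Fin n → V → ℂ, LinearIndependent ℂ g ∧
    (∀ i, (Function.support (g i)).Finite) ∧
    ∀ f ∈ Submodule.span ℂ (Set.range g), Q f ≤ lam * nrmSq m f

/-- Compact resolvent (equivalently: empty essential spectrum) of the non-negative
self-adjoint operator associated to the form `Q`, encoded via min-max:
`N_lam(H) < ∞` for every `lam`. -/
def CompactResolvent (Q : (V → ℂ) → ℝ) (m : V → ℝ) : Prop :=
  ∀ lam : ℝ, ∃ n : ℕ, ∀ k : ℕ, DimGE Q m lam k → k ≤ n

/-- The eigenvalue counting function `N_lam(H) = dim ran 1_{(-∞,lam]}(H)`,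
encoded via min-max over the form core. -/
def countEig (Q : (V → ℂ) → ℝ) (m : V → ℝ) (lam : ℝ) : ℕ :=
  sSup {k : ℕ | DimGE Q m lam k}

/-- The `n`-th eigenvalue (counted with multiplicity, `n` starting at `0`) of the
self-adjoint operator associated to `Q`, via the Courant min-max principle. -/
def eigVal (Q : (V → ℂ) → ℝ) (m : V → ℝ) (n : ℕ) : ℝ :=
  sInf {t : ℝ | DimGE Q m t (n + 1)}

/-- Equality of the form domains of the two non-negative forms `Q1`, `Q2`, both with
form core the finitely supported functions: by the closed graph theorem this is
equivalent to the equivalence of the form norms on the common core. -/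
def SameFormDomain (Q1 Q2 : (V → ℂ) → ℝ) (m : V → ℝ) : Prop :=
  ∃ c1 c2 : ℝ, 0 < c1 ∧ 0 < c2 ∧ ∀ f : V → ℂ, (Function.support f).Finite →
    c1 * (nrmSq m f + Q1 f) ≤ nrmSq m f + Q2 f ∧
      nrmSq m f + Q2 f ≤ c2 * (nrmSq m f + Q1 f)

/-- The summand of the magnetic quadratic form. -/
def edgeEnergy (E θ : V → V → ℝ) (f : V → ℂ) (x y : V) : ℝ :=
  E x y * ‖f x - Complex.exp (((θ x y : ℝ) : ℂ) * Complex.I) * f y‖ ^ 2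

/-- `IsWalkHol E θ x y t`: some walk from `x` to `y` has holonomy `t`. -/
inductive IsWalkHol (E θ : V → V → ℝ) : V → V → ℝ → Prop
  | refl (x : V) : IsWalkHol E θ x x 0
  | snoc {x y z : V} {t : ℝ} :
      IsWalkHol E θ x y t → 0 < E y z → IsWalkHol E θ x z (t + θ y z)

theorem quadForm_eq_half_tsum (E θ : V → V → ℝ) (f : V → ℂ) :
    quadForm E θ f = (1 / 2) * ∑' x, ∑' y, edgeEnergy E θ f x y := rfl

theorem edgeEnergy_nonneg {E : V → V → ℝ} (hE : ∀ x y, 0 ≤ E x y) (θ : V → V → ℝ)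
    (f : V → ℂ) (x y : V) : 0 ≤ edgeEnergy E θ f x y :=
  mul_nonneg (hE x y) (sq_nonneg _)

theorem quadForm_nonneg {E : V → V → ℝ} (hE : ∀ x y, 0 ≤ E x y) (θ : V → V → ℝ)
    (f : V → ℂ) : 0 ≤ quadForm E θ f := by
  rw [quadForm_eq_half_tsum]
  exact mul_nonneg (by norm_num)
    (tsum_nonneg fun x => tsum_nonneg fun y => edgeEnergy_nonneg hE θ f x y)

theorem nrmSq_nonneg {m : V → ℝ} (hm : ∀ x, 0 ≤ m x) (f : V → ℂ) : 0 ≤ nrmSq m f :=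
  tsum_nonneg fun x => mul_nonneg (hm x) (sq_nonneg _)

theorem fiberForm_nonneg {E2 : V2 → V2 → ℝ} (hE : ∀ x y, 0 ≤ E2 x y) (θ2 : V2 → V2 → ℝ)
    (f : V1 × V2 → ℂ) : 0 ≤ fiberForm E2 θ2 f :=
  tsum_nonneg fun _ => quadForm_nonneg hE θ2 _

section WeightedGraph

variable {E θ : V → V → ℝ} {m : V → ℝ} {f : V → ℂ}

theorem summable_mul_norm_sq (m : V → ℝ) (hf : (Function.support f).Finite) :
    Summable fun x => m x * ‖f x‖ ^ 2 := by
  refine summable_of_hasFiniteSupport (hf.subset fun x hx => ?_)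
  contrapose! hx
  simp_all

theorem GraphAxioms.finite_ne_zero (hG : GraphAxioms E m) (x : V) : {y | E x y ≠ 0}.Finite := by
  obtain ⟨-, hnn, -, -, hfin⟩ := hG
  exact (hfin x).subset fun y hy => lt_of_le_of_ne (hnn x y) (Ne.symm hy)

theorem GraphAxioms.finite_edges_meeting (hG : GraphAxioms E m)
    (hf : (Function.support f).Finite) :
    {p : V × V | E p.1 p.2 ≠ 0 ∧ (f p.1 ≠ 0 ∨ f p.2 ≠ 0)}.Finite := by
  have h : (⋃ x ∈ Function.support f, Set.image (Prod.mk x) {y | E x y ≠ 0}).Finite :=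
    hf.biUnion fun x _ => (hG.finite_ne_zero x).image _
  refine (h.union (h.image Prod.swap)).subset ?_
  rintro ⟨x, y⟩ ⟨hxy, hx | hy⟩
  · left
    simp only [Set.mem_iUnion]
    exact ⟨x, hx, y, hxy, rfl⟩
  · right
    refine ⟨(y, x), ?_, rfl⟩
    simp only [Set.mem_iUnion]
    exact ⟨y, hy, x, by simpa [hG.1 y x] using hxy, rfl⟩

theorem GraphAxioms.summable_edgeEnergy (hG : GraphAxioms E m) (θ : V → V → ℝ)
    (hf : (Function.support f).Finite) :
    Summable fun p : V × V => edgeEnergy E θ f p.1 p.2 := by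
  refine summable_of_hasFiniteSupport ((hG.finite_edges_meeting hf).subset fun p hp => ?_)
  simp only [Function.mem_support, edgeEnergy] at hp
  refine ⟨left_ne_zero_of_mul hp, ?_⟩
  contrapose! hp
  simp [hp.1, hp.2]

theorem edgeEnergy_le (hE : ∀ x y, 0 ≤ E x y) (θ : V → V → ℝ) (f : V → ℂ) (x y : V) :
    edgeEnergy E θ f x y ≤ 2 * (E x y * ‖f x‖ ^ 2) + 2 * (E x y * ‖f y‖ ^ 2) := by
  have h := norm_sub_le (f x) (Complex.exp (((θ x y : ℝ) : ℂ) * Complex.I) * f y)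
  rw [norm_mul, Complex.norm_exp_ofReal_mul_I, one_mul] at h
  have h2 : ‖f x - Complex.exp (((θ x y : ℝ) : ℂ) * Complex.I) * f y‖ ^ 2
      ≤ 2 * ‖f x‖ ^ 2 + 2 * ‖f y‖ ^ 2 := by
    have := pow_le_pow_left₀ (norm_nonneg _) h 2
    nlinarith [sq_nonneg (‖f x‖ - ‖f y‖)]
  have := mul_le_mul_of_nonneg_left h2 (hE x y)
  unfold edgeEnergy
  linarith

theorem GraphAxioms.quadForm_le (hG : GraphAxioms E m) (θ : V → V → ℝ) {d : ℝ}
    (hd : ∀ x, degree E m x ≤ d) (hf : (Function.support f).Finite) :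
    quadForm E θ f ≤ 2 * d * nrmSq m f := by
  have hs := hG.summable_edgeEnergy θ hf
  have hs1 : Summable fun p : V × V => E p.1 p.2 * ‖f p.1‖ ^ 2 := by
    refine summable_of_hasFiniteSupport ((hG.finite_edges_meeting hf).subset fun p hp => ?_)
    simp only [Function.mem_support] at hp
    exact ⟨left_ne_zero_of_mul hp, Or.inl (by simpa using right_ne_zero_of_mul hp)⟩
  have hswap : (fun p : V × V => E p.1 p.2 * ‖f p.2‖ ^ 2) =
      (fun p : V × V => E p.1 p.2 * ‖f p.1‖ ^ 2) ∘ Equiv.prodComm V V := by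
    funext p
    simp [hG.1 p.1 p.2]
  have hs2 : Summable fun p : V × V => E p.1 p.2 * ‖f p.2‖ ^ 2 := by
    rw [hswap, Equiv.summable_iff]
    exact hs1
  have heq : ∑' p : V × V, E p.1 p.2 * ‖f p.2‖ ^ 2 = ∑' p : V × V, E p.1 p.2 * ‖f p.1‖ ^ 2 := by
    rw [hswap]
    exact (Equiv.prodComm V V).tsum_eq (fun p : V × V => E p.1 p.2 * ‖f p.1‖ ^ 2)
  have hdeg : ∑' p : V × V, E p.1 p.2 * ‖f p.1‖ ^ 2 ≤ d * nrmSq m f := by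
    rw [hs1.tsum_prod, nrmSq, ← tsum_mul_left]
    refine hs1.prod.tsum_le_tsum (fun x => ?_) ((summable_mul_norm_sq m hf).mul_left d)
    have hm := hG.2.2.2.1 x
    have h := hd x
    rw [degree, inv_mul_le_iff₀ hm] at h
    simp only [tsum_mul_right]
    nlinarith [sq_nonneg ‖f x‖]
  have hle : ∑' p : V × V, edgeEnergy E θ f p.1 p.2 ≤
      2 * ∑' p : V × V, E p.1 p.2 * ‖f p.1‖ ^ 2 + 2 * ∑' p : V × V, E p.1 p.2 * ‖f p.2‖ ^ 2 := by
    rw [← tsum_mul_left, ← tsum_mul_left, ← (hs1.mul_left 2).tsum_add (hs2.mul_left 2)]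
    exact hs.tsum_le_tsum (fun p => edgeEnergy_le hG.2.1 θ f p.1 p.2)
      ((hs1.mul_left 2).add (hs2.mul_left 2))
  rw [quadForm_eq_half_tsum, ← hs.tsum_prod (f := fun p : V × V => edgeEnergy E θ f p.1 p.2)]
  linarith

end WeightedGraph

section Holonomy

variable {E θ : V → V → ℝ}

theorem IsWalkHol.trans {x y z : V} {s t : ℝ} (h : IsWalkHol E θ x y s)
    (h' : IsWalkHol E θ y z t) : IsWalkHol E θ x z (s + t) := by
  induction h' with
  | refl => simpa using h
  | snoc _ he ih => rw [← add_assoc]; exact ih.snoc he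

theorem IsWalkHol.symm (hE : ∀ x y, E x y = E y x) (hθ : ∀ x y, θ y x = -θ x y) {x y : V}
    {t : ℝ} (h : IsWalkHol E θ x y t) : IsWalkHol E θ y x (-t) := by
  induction h with
  | refl => simpa using IsWalkHol.refl x
  | @snoc y z t _ he ih =>
    have h1 : IsWalkHol E θ z y (0 + θ z y) := (IsWalkHol.refl z).snoc (by rwa [hE])
    have h2 := h1.trans ih
    rw [hθ y z] at h2
    convert h2 using 1
    ring

theorem Conn.exists_isWalkHol (hc : Conn E) (θ : V → V → ℝ) (x y : V) :
    ∃ t, IsWalkHol E θ x y t := by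
  induction hc x y with
  | refl => exact ⟨0, .refl x⟩
  | tail _ he ih => obtain ⟨t, ht⟩ := ih; exact ⟨_, ht.snoc he⟩

theorem IsWalkHol.exists_path {x y : V} {t : ℝ} (h : IsWalkHol E θ x y t) :
    ∃ (γ : ℕ → V) (N : ℕ), γ 0 = x ∧ γ N = y ∧ (∀ i < N, 0 < E (γ i) (γ (i + 1))) ∧
      hol θ γ N = t := by
  induction h with
  | refl => exact ⟨fun _ => x, 0, rfl, rfl, by simp, by simp [hol]⟩
  | @snoc y z t _ he ih =>
    obtain ⟨γ, N, h0, hN, hγ, hh⟩ := ih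
    have hlt : ∀ i, i ≤ N → (Function.update γ (N + 1) z) i = γ i := fun i hi =>
      Function.update_of_ne (by omega) _ _
    refine ⟨Function.update γ (N + 1) z, N + 1, by rw [hlt 0 (by omega), h0], by simp, ?_, ?_⟩
    · intro i hi
      rcases Nat.lt_succ_iff_lt_or_eq.mp hi with hi' | rfl
      · rw [hlt i (by omega), hlt (i + 1) (by omega)]
        exact hγ i hi'
      · rw [hlt i le_rfl, Function.update_self, hN]
        exact he
    · rw [hol, Finset.sum_range_succ, hlt N le_rfl, Function.update_self, hN, ← hh, hol]
      congr 1
      refine Finset.sum_congr rfl fun i hi => ?_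
      rw [Finset.mem_range] at hi
      rw [hlt i (by omega), hlt (i + 1) (by omega)]

theorem HolTrivial.exp_eq_one (h : HolTrivial E θ) {x : V} {t : ℝ} (ht : IsWalkHol E θ x x t) :
    Complex.exp ((t : ℂ) * Complex.I) = 1 := by
  obtain ⟨γ, N, h0, hN, hγ, hh⟩ := ht.exists_path
  obtain ⟨k, hk⟩ := h γ N ⟨hN.trans h0.symm, hγ⟩
  rw [Complex.exp_eq_one_iff]
  refine ⟨k, ?_⟩
  rw [← hh, hk]
  push_cast
  ring

/-- A magnetic potential without holonomy is pure gauge. -/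
theorem HolTrivial.exists_gauge (h : HolTrivial E θ) (hc : Conn E) (hE : ∀ x y, E x y = E y x)
    (hθ : ∀ x y, θ y x = -θ x y) (x₀ : V) :
    ∃ u : V → ℂ, (∀ x, u x ≠ 0) ∧
      ∀ x y, 0 < E x y → u x = Complex.exp (((θ x y : ℝ) : ℂ) * Complex.I) * u y := by
  choose t ht using fun x => hc.exists_isWalkHol θ x₀ x
  refine ⟨fun x => Complex.exp (((-t x : ℝ) : ℂ) * Complex.I), fun x => Complex.exp_ne_zero _,
    fun x y hxy => ?_⟩
  have hcyc := h.exp_eq_one (((ht x).snoc hxy).trans ((ht y).symm hE hθ))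
  beta_reduce
  rw [← Complex.exp_add, ← mul_one (Complex.exp (((-t x : ℝ) : ℂ) * Complex.I)), ← hcyc,
    ← Complex.exp_add]
  congr 1
  push_cast
  ring

theorem gauge_along_path {u : V → ℂ}
    (hu : ∀ x y, 0 < E x y → u x = Complex.exp (((θ x y : ℝ) : ℂ) * Complex.I) * u y)
    {γ : ℕ → V} {N : ℕ} (hγ : ∀ i < N, 0 < E (γ i) (γ (i + 1))) :
    u (γ 0) = Complex.exp (((hol θ γ N : ℝ) : ℂ) * Complex.I) * u (γ N) := by
  induction N with
  | zero => simp [hol]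
  | succ n ih =>
    rw [ih fun i hi => hγ i (by omega), hu _ _ (hγ n (by omega)), ← mul_assoc, ← Complex.exp_add]
    congr 2
    rw [hol, hol, Finset.sum_range_succ]
    push_cast
    ring

theorem holTrivial_of_gauge {u : V → ℂ} (hc : Conn E)
    (hu : ∀ x y, 0 < E x y → u x = Complex.exp (((θ x y : ℝ) : ℂ) * Complex.I) * u y)
    (hne : u ≠ 0) : HolTrivial E θ := by
  obtain ⟨z, hz⟩ := Function.ne_iff.mp hne
  have hall : ∀ x, u x ≠ 0 := by
    intro x hx
    have hprop : ∀ w, u w = 0 := by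
      intro w
      induction hc x w with
      | refl => exact hx
      | tail _ he ih =>
        rw [hu _ _ he] at ih
        exact (mul_eq_zero.mp ih).resolve_left (Complex.exp_ne_zero _)
    exact hz (hprop z)
  rintro γ N ⟨hN, hγ⟩
  have h := gauge_along_path hu hγ
  rw [hN] at h
  have h1 := (mul_eq_right₀ (hall (γ 0))).mp h.symm
  obtain ⟨k, hk⟩ := Complex.exp_eq_one_iff.mp h1
  refine ⟨k, ?_⟩
  have h2 : ((hol θ γ N : ℝ) : ℂ) = ((2 * Real.pi * k : ℝ) : ℂ) := by
    apply mul_right_cancel₀ Complex.I_ne_zero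
    rw [hk]
    push_cast
    ring
  exact_mod_cast h2

end Holonomy

section FiniteGraph

variable [Fintype V] {E θ : V → V → ℝ}

theorem quadForm_eq_sum (E θ : V → V → ℝ) (f : V → ℂ) :
    quadForm E θ f = (1 / 2) * ∑ x, ∑ y, edgeEnergy E θ f x y := by
  simp only [quadForm_eq_half_tsum, tsum_fintype]

theorem quadForm_eq_zero_iff (hE : ∀ x y, 0 ≤ E x y) (f : V → ℂ) :
    quadForm E θ f = 0 ↔
      ∀ x y, 0 < E x y → f x = Complex.exp (((θ x y : ℝ) : ℂ) * Complex.I) * f y := by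
  rw [quadForm_eq_sum, mul_eq_zero_iff_left (by norm_num), Finset.sum_eq_zero_iff_of_nonneg
    fun x _ => Finset.sum_nonneg fun y _ => edgeEnergy_nonneg hE θ f x y]
  refine forall_congr' fun x => ?_
  simp only [Finset.mem_univ, true_imp_iff]
  rw [Finset.sum_eq_zero_iff_of_nonneg fun y _ => edgeEnergy_nonneg hE θ f x y]
  refine forall_congr' fun y => ?_
  simp only [Finset.mem_univ, true_imp_iff, edgeEnergy, mul_eq_zero, ne_eq, OfNat.ofNat_ne_zero,
    not_false_eq_true, pow_eq_zero_iff, norm_eq_zero, sub_eq_zero]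
  constructor
  · exact fun h hpos => h.resolve_left hpos.ne'
  · exact fun h => (hE x y).eq_or_lt.imp (fun h0 => h0.symm) h

theorem quadForm_smul (E θ : V → V → ℝ) (c : ℂ) (f : V → ℂ) :
    quadForm E θ (c • f) = ‖c‖ ^ 2 * quadForm E θ f := by
  have h : ∀ x y, edgeEnergy E θ (c • f) x y = ‖c‖ ^ 2 * edgeEnergy E θ f x y := by
    intro x y
    have : (c • f) x - Complex.exp (((θ x y : ℝ) : ℂ) * Complex.I) * (c • f) y =
        c * (f x - Complex.exp (((θ x y : ℝ) : ℂ) * Complex.I) * f y) := by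
      simp only [Pi.smul_apply, smul_eq_mul]
      ring
    rw [edgeEnergy, edgeEnergy, this, norm_mul]
    ring
  simp only [quadForm_eq_sum, h, ← Finset.mul_sum]
  ring

/-- On a finite connected graph with nontrivial holonomy the magnetic form is coercive. -/
theorem exists_coercive_of_not_holTrivial [Nonempty V] (hE : ∀ x y, 0 ≤ E x y) (hc : Conn E)
    (h : ¬HolTrivial E θ) :
    ∃ c : ℝ, 0 < c ∧ ∀ f : V → ℂ, c * ∑ x, ‖f x‖ ^ 2 ≤ quadForm E θ f := by
  have hcont : Continuous (quadForm E θ) := by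
    have : quadForm E θ = fun f => (1 / 2) * ∑ x, ∑ y, edgeEnergy E θ f x y :=
      funext (quadForm_eq_sum E θ)
    rw [this]
    unfold edgeEnergy
    fun_prop
  obtain ⟨f₀, hf₀, hmin⟩ := (isCompact_sphere (0 : V → ℂ) 1).exists_isMinOn
    (NormedSpace.sphere_nonempty.mpr zero_le_one) hcont.continuousOn
  have hf₀n : f₀ ≠ 0 := by
    rintro rfl
    simp at hf₀
  have hpos : 0 < quadForm E θ f₀ := by
    refine lt_of_le_of_ne (quadForm_nonneg hE θ f₀) fun h0 => h ?_
    exact holTrivial_of_gauge hc ((quadForm_eq_zero_iff hE f₀).mp h0.symm) hf₀n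
  have hcard : (0 : ℝ) < Fintype.card V := by exact_mod_cast Fintype.card_pos
  have hsup : ∀ f : V → ℂ, quadForm E θ f₀ * ‖f‖ ^ 2 ≤ quadForm E θ f := by
    intro f
    rcases eq_or_ne f 0 with rfl | hf
    · simpa using quadForm_nonneg hE θ (0 : V → ℂ)
    have hn : (0 : ℝ) < ‖f‖ := norm_pos_iff.mpr hf
    have hmem : ((‖f‖⁻¹ : ℝ) : ℂ) • f ∈ Metric.sphere (0 : V → ℂ) 1 := by
      simp [norm_smul, hn.ne']
    have := hmin hmem
    simp only [Set.mem_ofPred_eq] at this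
    rw [quadForm_smul, Complex.norm_real, Real.norm_eq_abs, sq_abs, inv_pow,
      le_inv_mul_iff₀ (by positivity)] at this
    linarith
  refine ⟨quadForm E θ f₀ / Fintype.card V, by positivity, fun f => ?_⟩
  have hle : ∑ x, ‖f x‖ ^ 2 ≤ Fintype.card V * ‖f‖ ^ 2 := by
    calc ∑ x, ‖f x‖ ^ 2 ≤ ∑ _x : V, ‖f‖ ^ 2 :=
          Finset.sum_le_sum fun x _ => pow_le_pow_left₀ (norm_nonneg _) (norm_le_pi_norm f x) 2
      _ = Fintype.card V * ‖f‖ ^ 2 := by simp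
  refine le_trans ?_ (hsup f)
  rw [div_mul_eq_mul_div, div_le_iff₀ hcard]
  nlinarith

end FiniteGraph

section Product

variable {f : V1 × V2 → ℂ}

theorem finite_support_slice_fst (hf : (Function.support f).Finite) (y : V2) :
    (Function.support fun x => f (x, y)).Finite :=
  (hf.image Prod.fst).subset fun x hx => ⟨(x, y), hx, rfl⟩

theorem edgeEnergy_prod {E1 θ1 : V1 → V1 → ℝ} {E2 θ2 : V2 → V2 → ℝ}
    (h1 : ∀ x, E1 x x = 0) (h2 : ∀ y, E2 y y = 0) (I : Set V2) (f : V1 × V2 → ℂ) (p q : V1 × V2) :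
    edgeEnergy (prodE E1 E2 I) (prodTheta θ1 θ2) f p q =
      (if q.2 = p.2 then
        (if p.2 ∈ I then edgeEnergy E1 θ1 (fun x => f (x, p.2)) p.1 q.1 else 0) else 0) +
      (if q.1 = p.1 then edgeEnergy E2 θ2 (fun y => f (p.1, y)) p.2 q.2 else 0) := by
  obtain ⟨x, y⟩ := p
  obtain ⟨x', y'⟩ := q
  simp only [edgeEnergy, prodE, prodTheta]
  by_cases hx : x = x'
  · subst hx
    by_cases hy : y = y'
    · subst hy
      simp [h1, h2]
    · simp [hy, Ne.symm hy]
  · by_cases hy : y = y'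
    · subst hy
      by_cases hI : y ∈ I <;> simp [hx, Ne.symm hx, hI]
    · simp [hx, hy, Ne.symm hx, Ne.symm hy]

variable [Fintype V2]

theorem nrmSq_prodM (m1 : V1 → ℝ) (m2 : V2 → ℝ) (hf : (Function.support f).Finite) :
    nrmSq (prodM m1 m2) f = ∑ y, m2 y * nrmSq m1 fun x => f (x, y) := by
  have hs := summable_mul_norm_sq (prodM m1 m2) hf
  have hs' : Summable fun q : V2 × V1 => prodM m1 m2 q.swap * ‖f q.swap‖ ^ 2 :=
    (Equiv.prodComm V2 V1).summable_iff.mpr hs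
  rw [nrmSq, ← (Equiv.prodComm V2 V1).tsum_eq]
  simp only [Equiv.prodComm_apply]
  rw [hs'.tsum_prod, tsum_fintype]
  refine Finset.sum_congr rfl fun y _ => ?_
  rw [nrmSq, ← tsum_mul_left]
  refine tsum_congr fun x => ?_
  simp only [prodM, Prod.swap_prod_mk]
  ring

theorem quadForm_prod {E1 θ1 : V1 → V1 → ℝ} {m1 : V1 → ℝ} {E2 θ2 : V2 → V2 → ℝ} {m2 : V2 → ℝ}
    (hG1 : GraphAxioms E1 m1) (hG2 : GraphAxioms E2 m2) (I : Set V2)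
    (hf : (Function.support f).Finite) :
    quadForm (prodE E1 E2 I) (prodTheta θ1 θ2) f =
      fiberForm E2 θ2 f + ∑ y, if y ∈ I then quadForm E1 θ1 (fun x => f (x, y)) else 0 := by
  set A : V1 × V2 → ℝ := fun p =>
    if p.2 ∈ I then ∑' x', edgeEnergy E1 θ1 (fun x => f (x, p.2)) p.1 x' else 0 with hA
  set B : V1 × V2 → ℝ := fun p => ∑ y', edgeEnergy E2 θ2 (fun y => f (p.1, y)) p.2 y' with hB
  have hslice := fun y => hG1.summable_edgeEnergy θ1 (finite_support_slice_fst hf y)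
  have hsum1 : ∀ p : V1 × V2, HasSum (fun q : V1 × V2 => if q.2 = p.2 then
      (if p.2 ∈ I then edgeEnergy E1 θ1 (fun x => f (x, p.2)) p.1 q.1 else 0) else 0) (A p) := by
    intro p
    have hinj : Function.Injective fun x' : V1 => (x', p.2) := fun a b h => (Prod.mk.inj h).1
    rw [← hinj.hasSum_iff]
    · by_cases hI : p.2 ∈ I
      · simp only [hA, Function.comp_def, hI, if_true]
        exact ((hslice p.2).prod_factor p.1).hasSum
      · simp only [hA, Function.comp_def, hI, if_true, if_false]
        exact hasSum_zero
    · rintro ⟨x', y'⟩ hq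
      refine if_neg fun h => hq ⟨x', ?_⟩
      simp only at h
      rw [h]
  have hsum2 : ∀ p : V1 × V2, HasSum (fun q : V1 × V2 => if q.1 = p.1 then
      edgeEnergy E2 θ2 (fun y => f (p.1, y)) p.2 q.2 else 0) (B p) := by
    intro p
    have hinj : Function.Injective fun y' : V2 => (p.1, y') := fun a b h => (Prod.mk.inj h).2
    rw [← hinj.hasSum_iff]
    · simp only [hB, Function.comp_def, if_true]
      exact hasSum_fintype _
    · rintro ⟨x', y'⟩ hq
      refine if_neg fun h => hq ⟨y', ?_⟩
      simp only at h
      rw [h]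
  have hinner : ∀ p, ∑' q, edgeEnergy (prodE E1 E2 I) (prodTheta θ1 θ2) f p q = A p + B p := by
    intro p
    simp only [edgeEnergy_prod hG1.2.2.1 hG2.2.2.1 I f p]
    exact ((hsum1 p).add (hsum2 p)).tsum_eq
  have hAs : Summable fun q : V2 × V1 => A q.swap := by
    have hA0 : 0 ≤ fun p : V1 × V2 => A p := fun p => by
      simp only [hA, Pi.zero_apply]
      split_ifs
      · exact tsum_nonneg fun _ => edgeEnergy_nonneg hG1.2.1 _ _ _ _
      · exact le_rfl
    refine (Equiv.prodComm V2 V1).summable_iff.mpr ((summable_prod_of_nonneg hA0).mpr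
      ⟨fun x => (hasSum_fintype _).summable, ?_⟩)
    simp only [tsum_fintype]
    refine summable_sum fun y _ => ?_
    by_cases hI : y ∈ I
    · simpa only [hA, hI, if_true] using (hslice y).prod
    · simpa only [hA, hI, if_false] using summable_zero
  have hBs : Summable B := by
    refine summable_of_hasFiniteSupport (((hf.image Prod.fst).prod Set.finite_univ).subset ?_)
    rintro ⟨x, y⟩ hp
    refine ⟨?_, Set.mem_univ _⟩
    by_contra hx
    have hz : ∀ y, f (x, y) = 0 := fun y => by
      by_contra hy
      exact hx ⟨(x, y), hy, rfl⟩
    exact hp (by simp [hB, edgeEnergy, hz])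
  have hAs' : Summable A := (Equiv.prodComm V2 V1).summable_iff.mp hAs
  rw [quadForm_eq_half_tsum]
  simp only [hinner]
  rw [hAs'.tsum_add hBs, hBs.tsum_prod, ← (Equiv.prodComm V2 V1).tsum_eq A]
  simp only [Equiv.prodComm_apply]
  rw [hAs.tsum_prod, tsum_fintype, mul_add, add_comm, Finset.mul_sum, ← tsum_mul_left]
  congr 1
  · refine tsum_congr fun x => ?_
    rw [quadForm_eq_sum, tsum_fintype]
  · refine Finset.sum_congr rfl fun y _ => ?_
    by_cases hI : y ∈ I
    · simp only [hA, Prod.swap_prod_mk, hI, if_true, quadForm_eq_half_tsum]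
    · simp [hA, hI]

end Product

theorem finite_support_of_mem_span {k : ℕ} {g : Fin k → V → ℂ}
    (hg : ∀ i, (Function.support (g i)).Finite) {f : V → ℂ}
    (hf : f ∈ Submodule.span ℂ (Set.range g)) : (Function.support f).Finite := by
  induction hf using Submodule.span_induction with
  | mem f hf => obtain ⟨i, rfl⟩ := hf; exact hg i
  | zero => simp
  | add a b _ _ ha hb => exact (ha.union hb).subset (Function.support_add a b)
  | smul c a _ ha => exact ha.subset (Function.support_const_smul_subset c a)

theorem exists_pos_le_of_fintype [Fintype V] {m : V → ℝ} (hm : ∀ x, 0 < m x) :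
    ∃ μ : ℝ, 0 < μ ∧ ∀ x, μ ≤ m x := by
  rcases isEmpty_or_nonempty V with h | h
  · exact ⟨1, one_pos, fun x => h.elim x⟩
  · obtain ⟨x₀, h₀⟩ := Finite.exists_min m
    exact ⟨m x₀, hm x₀, h₀⟩

section Cusp

variable [Fintype V2] {E1 θ1 : V1 → V1 → ℝ} {m1 : V1 → ℝ} {E2 θ2 : V2 → V2 → ℝ} {m2 : V2 → ℝ}
  {f : V1 × V2 → ℂ}

theorem fiberForm_le_quadForm (hG1 : GraphAxioms E1 m1) (hG2 : GraphAxioms E2 m2)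
    (I : Set V2) (hf : (Function.support f).Finite) :
    fiberForm E2 θ2 f ≤ quadForm (prodE E1 E2 I) (prodTheta θ1 θ2) f := by
  rw [quadForm_prod hG1 hG2 I hf]
  refine le_add_of_nonneg_right (Finset.sum_nonneg fun y _ => ?_)
  split_ifs
  · exact quadForm_nonneg hG1.2.1 _ _
  · exact le_rfl

theorem exists_quadForm_le_fiberForm_add (hG1 : GraphAxioms E1 m1) (hG2 : GraphAxioms E2 m2)
    (I : Set V2) (hH3 : H3cond E1 m1) :
    ∃ K : ℝ, 0 ≤ K ∧ ∀ f : V1 × V2 → ℂ, (Function.support f).Finite →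
      quadForm (prodE E1 E2 I) (prodTheta θ1 θ2) f ≤
        fiberForm E2 θ2 f + K * nrmSq (prodM m1 m2) f := by
  obtain ⟨d, hd⟩ := hH3
  obtain ⟨μ, hμ, hμm⟩ := exists_pos_le_of_fintype hG2.2.2.2.1
  refine ⟨2 * |d| / μ, by positivity, fun f hf => ?_⟩
  rw [quadForm_prod hG1 hG2 I hf, nrmSq_prodM m1 m2 hf, Finset.mul_sum]
  refine add_le_add le_rfl (Finset.sum_le_sum fun y _ => ?_)
  have hn : 0 ≤ nrmSq m1 fun x => f (x, y) := nrmSq_nonneg (fun x => (hG1.2.2.2.1 x).le) _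
  have hq : quadForm E1 θ1 (fun x => f (x, y)) ≤ 2 * |d| * nrmSq m1 fun x => f (x, y) :=
    hG1.quadForm_le θ1 (fun x => (hd x).trans (le_abs_self d)) (finite_support_slice_fst hf y)
  have hm : 2 * |d| * (nrmSq m1 fun x => f (x, y)) ≤
      2 * |d| / μ * (m2 y * nrmSq m1 fun x => f (x, y)) := by
    rw [div_mul_eq_mul_div, le_div_iff₀ hμ]
    have := mul_le_mul_of_nonneg_left (hμm y)
      (mul_nonneg (mul_nonneg zero_le_two (abs_nonneg d)) hn)
    linarith
  split_ifs
  · exact hq.trans hm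
  · exact le_trans (mul_nonneg (by positivity) hn) hm

theorem sameFormDomain_fiberForm (hG1 : GraphAxioms E1 m1) (hG2 : GraphAxioms E2 m2)
    (I : Set V2) (hH3 : H3cond E1 m1) :
    SameFormDomain (quadForm (prodE E1 E2 I) (prodTheta θ1 θ2))
      (fiberForm (V1 := V1) E2 θ2) (prodM m1 m2) := by
  obtain ⟨K, hK, hle⟩ := exists_quadForm_le_fiberForm_add (θ1 := θ1) (θ2 := θ2) hG1 hG2 I hH3
  refine ⟨(1 + K)⁻¹, 1, by positivity, one_pos, fun f hf => ⟨?_, ?_⟩⟩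
  · rw [inv_mul_le_iff₀ (by positivity)]
    have := hle f hf
    have := mul_nonneg hK (fiberForm_nonneg hG2.2.1 θ2 f)
    linarith
  · have := fiberForm_le_quadForm (θ1 := θ1) (θ2 := θ2) hG1 hG2 I hf
    linarith

theorem not_compactResolvent_of_holTrivial [Infinite V1] [Nonempty V2] (hG1 : GraphAxioms E1 m1)
    (hG2 : GraphAxioms E2 m2) (hθ2 : MagneticPotential E2 θ2)
    (I : Set V2) (hconn2 : Conn E2) (hH3 : H3cond E1 m1) (hhol : HolTrivial E2 θ2) :
    ¬CompactResolvent (quadForm (prodE E1 E2 I) (prodTheta θ1 θ2)) (prodM m1 m2) := by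
  obtain ⟨K, -, hle⟩ := exists_quadForm_le_fiberForm_add (θ1 := θ1) (θ2 := θ2) hG1 hG2 I hH3
  obtain ⟨y₀⟩ := ‹Nonempty V2›
  obtain ⟨u, hu0, hu⟩ := hhol.exists_gauge hconn2 hG2.1 hθ2.1 y₀
  intro hcomp
  obtain ⟨n, hn⟩ := hcomp K
  obtain ⟨e⟩ : Nonempty (Fin (n + 1) ↪ V1) := ⟨Fin.valEmbedding.trans (Infinite.natEmbedding V1)⟩
  set g : Fin (n + 1) → V1 × V2 → ℂ := fun i p => if p.1 = e i then u p.2 else 0 with hgdef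
  have hgfin : ∀ i, (Function.support (g i)).Finite := by
    intro i
    refine ((Set.finite_singleton (e i)).prod (Set.finite_univ (α := V2))).subset ?_
    rintro ⟨x, y⟩ hp
    refine ⟨?_, Set.mem_univ _⟩
    by_contra hx
    exact hp (if_neg hx)
  refine (Nat.lt_irrefl n) (hn (n + 1) ⟨g, ?_, hgfin, ?_⟩)
  · rw [Fintype.linearIndependent_iff]
    intro c hc i
    have h := congrFun hc (e i, y₀)
    simpa [hgdef, Finset.sum_apply, e.injective.eq_iff, hu0 y₀] using h
  · intro f hf
    have hform : ∃ φ : V1 → ℂ, ∀ x y, f (x, y) = φ x * u y := by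
      induction hf using Submodule.span_induction with
      | mem f hf =>
        obtain ⟨i, rfl⟩ := hf
        exact ⟨fun x => if x = e i then 1 else 0, fun x y => by simp [hgdef]⟩
      | zero => exact ⟨0, by simp⟩
      | add a b _ _ ha hb =>
        obtain ⟨φ, hφ⟩ := ha
        obtain ⟨ψ, hψ⟩ := hb
        exact ⟨φ + ψ, fun x y => by simp [hφ, hψ, add_mul]⟩
      | smul c a _ ha =>
        obtain ⟨φ, hφ⟩ := ha
        exact ⟨c • φ, fun x y => by simp [hφ, mul_assoc]⟩
    have hfin := finite_support_of_mem_span hgfin hf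
    obtain ⟨φ, hφ⟩ := hform
    have hzero : fiberForm E2 θ2 f = 0 := by
      have hx : ∀ x, quadForm E2 θ2 (fun y => f (x, y)) = 0 := fun x => by
        rw [quadForm_eq_zero_iff hG2.2.1]
        intro y y' hy
        rw [hφ, hφ, hu y y' hy]
        ring
      simp [fiberForm, hx]
    simpa [hzero] using hle f hfin

theorem compactResolvent_of_not_holTrivial [Nonempty V2] (hG1 : GraphAxioms E1 m1)
    (hG2 : GraphAxioms E2 m2) (I : Set V2) (hconn2 : Conn E2) (hH1 : H1cond m1)
    (hhol : ¬HolTrivial E2 θ2) :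
    CompactResolvent (quadForm (prodE E1 E2 I) (prodTheta θ1 θ2)) (prodM m1 m2) := by
  obtain ⟨c, hc, hcoer⟩ := exists_coercive_of_not_holTrivial hG2.2.1 hconn2 hhol
  obtain ⟨y₀, hM⟩ := Finite.exists_max m2
  have hM0 : 0 < m2 y₀ := hG2.2.2.2.1 y₀
  intro lam
  have hden : 0 < (|lam| + 1) * m2 y₀ := by positivity
  have hA := hH1.2 (c / ((|lam| + 1) * m2 y₀)) (by positivity)
  set S : Finset (V1 × V2) := hA.toFinset ×ˢ Finset.univ with hS
  refine ⟨S.card, fun k hk => ?_⟩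
  obtain ⟨g, hli, hgfin, hg⟩ := hk
  let R : (V1 × V2 → ℂ) →ₗ[ℂ] (S → ℂ) := LinearMap.funLeft ℂ ℂ (fun p : S => (p : V1 × V2))
  have hdisj : Disjoint (Submodule.span ℂ (Set.range g)) (LinearMap.ker R) := by
    rw [Submodule.disjoint_def]
    intro f hf hR
    have hfin := finite_support_of_mem_span hgfin hf
    have hvan : ∀ p ∈ S, f p = 0 := fun p hp => congrFun (LinearMap.mem_ker.mp hR) ⟨p, hp⟩
    have hs := summable_mul_norm_sq (fun _ : V1 × V2 => c) hfin
    have hs' := (summable_mul_norm_sq (prodM m1 m2) hfin).mul_left lam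
    have hlow : ∑' p, c * ‖f p‖ ^ 2 ≤ fiberForm E2 θ2 f := by
      rw [hs.tsum_prod]
      refine hs.prod.tsum_le_tsum (fun x => ?_) ?_
      · rw [tsum_fintype, ← Finset.mul_sum]
        exact hcoer fun y => f (x, y)
      · refine summable_of_hasFiniteSupport ((hfin.image Prod.fst).subset fun x hx => ?_)
        by_contra hxn
        refine hx ((quadForm_eq_zero_iff hG2.2.1 _).mpr fun y y' _ => ?_)
        have hz : ∀ y, f (x, y) = 0 := fun y => by
          by_contra hy
          exact hxn ⟨(x, y), hy, rfl⟩
        simp [hz]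
    have hup : fiberForm E2 θ2 f ≤ ∑' p, lam * (prodM m1 m2 p * ‖f p‖ ^ 2) := by
      rw [tsum_mul_left]
      exact (fiberForm_le_quadForm (θ1 := θ1) (θ2 := θ2) hG1 hG2 I hfin).trans (hg f hf)
    by_contra hne
    obtain ⟨p₀, hp₀⟩ := Function.ne_iff.mp hne
    have hlt : ∀ p, f p ≠ 0 → lam * (prodM m1 m2 p * ‖f p‖ ^ 2) < c * ‖f p‖ ^ 2 := by
      intro p hp
      have hpS : p ∉ S := fun h => hp (hvan p h)
      have hsmall : m1 p.1 < c / ((|lam| + 1) * m2 y₀) := by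
        by_contra hcon
        exact hpS (by simpa [hS] using not_lt.mp hcon)
      rw [lt_div_iff₀ hden] at hsmall
      have hm1 := hG1.2.2.2.1 p.1
      have hm2 := hG2.2.2.2.1 p.2
      have hsq : 0 < ‖f p‖ ^ 2 := by positivity
      have hmul : lam * prodM m1 m2 p < c := by
        calc lam * prodM m1 m2 p ≤ (|lam| + 1) * (m1 p.1 * m2 y₀) := by
              unfold prodM
              have h1 : lam ≤ |lam| + 1 := (le_abs_self lam).trans (by linarith)
              have h2 : m1 p.1 * m2 p.2 ≤ m1 p.1 * m2 y₀ :=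
                mul_le_mul_of_nonneg_left (hM p.2) hm1.le
              exact mul_le_mul h1 h2 (by positivity) (by positivity)
          _ = m1 p.1 * ((|lam| + 1) * m2 y₀) := by ring
          _ < c := hsmall
      nlinarith
    have hstrict := hs'.tsum_lt_tsum (fun p => ?_) (hlt p₀ hp₀) hs
    · linarith
    · rcases eq_or_ne (f p) 0 with h0 | h0
      · simp [h0]
      · exact (hlt p h0).le
  have hcard := (hli.map hdisj).fintype_card_le_finrank
  simpa using hcard

end Cusp

/-- For a discrete cusp `G = G1 ×_I G2` with `I` nonempty:
`D(Δ_{G,θ}^{1/2}) = D((m1⁻¹(·) ⊗ Δ_{G2,θ2})^{1/2})`, and `Δ_{G,θ}` has compact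
resolvent iff `Hol_{θ2} ≠ 0`. -/
theorem form_domain_and_compact_resolvent_iff
    [Fintype V2]
    (E1 : V1 → V1 → ℝ) (m1 : V1 → ℝ) (θ1 : V1 → V1 → ℝ)
    (E2 : V2 → V2 → ℝ) (m2 : V2 → ℝ) (θ2 : V2 → V2 → ℝ)
    (I : Set V2) (hI : I.Nonempty)
    (hG1 : GraphAxioms E1 m1) (hG2 : GraphAxioms E2 m2)
    (hθ1 : MagneticPotential E1 θ1) (hθ2 : MagneticPotential E2 θ2)
    (hconn1 : Conn E1) (hconn2 : Conn E2)
    (hH1 : H1cond m1) (hH3 : H3cond E1 m1) :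
    SameFormDomain (quadForm (prodE E1 E2 I) (prodTheta θ1 θ2))
        (fiberForm (V1 := V1) E2 θ2) (prodM m1 m2) ∧
      (CompactResolvent (quadForm (prodE E1 E2 I) (prodTheta θ1 θ2)) (prodM m1 m2) ↔
        ¬HolTrivial E2 θ2) := by
  obtain ⟨y₀, -⟩ := hI
  have : Nonempty V2 := ⟨y₀⟩
  have : Infinite V1 := hH1.1
  refine ⟨sameFormDomain_fiberForm hG1 hG2 I hH3, fun hcomp hhol => ?_,
    compactResolvent_of_not_holTrivial hG1 hG2 I hconn2 hH1⟩
  exact not_compactResolvent_of_holTrivial hG1 hG2 hθ2 I hconn2 hH3 hhol hcomp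

end MagneticCusp
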